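/- The Fermat cubic admits a twistor structure with five twistor lines: there exists a ℂ-linear automorphism g of ℂ⁴ such that the zero locus of z₁³ + z₂³ + z₃³ + z₄³ contains exactly five lines invariant under the twistor structure g ∘ j ∘ g⁻¹, i.e. exactly five 2-dimensional ℂ-subspaces W with (g ∘ j ∘ g⁻¹)(W) = W on which z₁³ + z₂³ + z₃³ + z₄³ vanishes identically. -/

import Mathlib

noncomputable section

open MvPolynomial

/-- The standard twistor structure `j : ℂ⁴ → ℂ⁴`,
`j(z₁,z₂,z₃,z₄) = (−z̄₂, z̄₁, −z̄₄, z̄₃)`. -/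
def J : (Fin 4 → ℂ) → (Fin 4 → ℂ) :=
  fun z => ![-(starRingEnd ℂ) (z 1), (starRingEnd ℂ) (z 0),
             -(starRingEnd ℂ) (z 3), (starRingEnd ℂ) (z 2)]

/-- A line in `ℙ³(ℂ)`: a 2-dimensional `ℂ`-subspace of `ℂ⁴`. -/
def IsLine (W : Submodule ℂ (Fin 4 → ℂ)) : Prop := Module.finrank ℂ W = 2

/-- A twistor line: a line whose underlying subspace satisfies `j(W) = W`. -/
def IsTwistorLine (W : Submodule ℂ (Fin 4 → ℂ)) : Prop :=
  IsLine W ∧ J '' (W : Set (Fin 4 → ℂ)) = (W : Set (Fin 4 → ℂ))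

/-- A polynomial vanishes identically on a subspace. -/
def VanishesOn (f : MvPolynomial (Fin 4) ℂ) (W : Submodule ℂ (Fin 4 → ℂ)) : Prop :=
  ∀ z ∈ W, eval z f = 0

/-- The surface `{f = 0}` is nonsingular: no nonzero point of `ℂ⁴` is a common zero of
`f` and all its partial derivatives. -/
def Nonsingular (f : MvPolynomial (Fin 4) ℂ) : Prop :=
  ∀ z : Fin 4 → ℂ, z ≠ 0 → eval z f = 0 → ∃ i, eval z (pderiv i f) ≠ 0

open ComplexConjugate

theorem J_J (z : Fin 4 → ℂ) : J (J z) = -z := by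
  ext i
  fin_cases i <;> simp [J]

theorem isTwistorLine_of_forall_mem {W : Submodule ℂ (Fin 4 → ℂ)} (hW : IsLine W)
    (h : ∀ z ∈ W, J z ∈ W) : IsTwistorLine W := by
  refine ⟨hW, Set.Subset.antisymm ?_ fun z hz => ?_⟩
  · rintro _ ⟨z, hz, rfl⟩
    exact h z hz
  · refine ⟨J (-z), h _ (W.neg_mem hz), ?_⟩
    rw [J_J, neg_neg]

theorem IsTwistorLine.J_mem {W : Submodule ℂ (Fin 4 → ℂ)} (hW : IsTwistorLine W)
    {z : Fin 4 → ℂ} (hz : z ∈ W) : J z ∈ W := by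
  have : J z ∈ J '' (W : Set (Fin 4 → ℂ)) := ⟨z, hz, rfl⟩
  rwa [hW.2] at this

/-- The subspace spanned by `(s, 0, t, 0)` and its image under `J`. -/
def conjSpan (s t : ℂ) : Submodule ℂ (Fin 4 → ℂ) :=
  Submodule.span ℂ {![s, 0, t, 0], ![0, conj s, 0, conj t]}

theorem mem_conjSpan {s t : ℂ} {z : Fin 4 → ℂ} :
    z ∈ conjSpan s t ↔ ∃ a b : ℂ, z = ![a * s, b * conj s, a * t, b * conj t] := by
  rw [conjSpan, Submodule.mem_span_pair]
  simp [eq_comm]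

theorem isLine_conjSpan {s t : ℂ} (h : s ≠ 0 ∨ t ≠ 0) : IsLine (conjSpan s t) := by
  have hli : LinearIndependent ℂ ![![s, 0, t, 0], ![0, conj s, 0, conj t]] := by
    rw [LinearIndependent.pair_iff]
    intro a b hab
    have h0 := congrFun hab 0
    have h1 := congrFun hab 1
    have h2 := congrFun hab 2
    have h3 := congrFun hab 3
    simp at h0 h1 h2 h3
    tauto
  have := finrank_span_eq_card hli
  rw [Matrix.range_cons_cons_empty] at this
  exact this.trans (Fintype.card_fin 2)

theorem isTwistorLine_conjSpan {s t : ℂ} (h : s ≠ 0 ∨ t ≠ 0) :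
    IsTwistorLine (conjSpan s t) := by
  refine isTwistorLine_of_forall_mem (isLine_conjSpan h) fun z hz => ?_
  obtain ⟨a, b, rfl⟩ := mem_conjSpan.1 hz
  refine mem_conjSpan.2 ⟨-conj b, conj a, ?_⟩
  simp [J]

theorem IsTwistorLine.eq_conjSpan {W : Submodule ℂ (Fin 4 → ℂ)} (hW : IsTwistorLine W)
    {s t : ℂ} (h : s ≠ 0 ∨ t ≠ 0) (hst : ![s, 0, t, 0] ∈ W) : W = conjSpan s t := by
  have hle : conjSpan s t ≤ W := by
    rw [conjSpan, Submodule.span_le, Set.insert_subset_iff, Set.singleton_subset_iff]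
    refine ⟨hst, ?_⟩
    simpa [J] using hW.J_mem hst
  exact (Submodule.eq_of_le_of_finrank_eq hle ((isLine_conjSpan h).trans hW.1.symm)).symm

/-- If `y₀² y₃ + y₂² y₁` vanishes on a twistor line, then the line meets `y₁ = y₃ = 0`. -/
theorem IsTwistorLine.exists_mem {W : Submodule ℂ (Fin 4 → ℂ)} (hW : IsTwistorLine W)
    (hF : ∀ y ∈ W, y 0 ^ 2 * y 3 + y 2 ^ 2 * y 1 = 0) :
    ∃ s t : ℂ, (s ≠ 0 ∨ t ≠ 0) ∧ ![s, 0, t, 0] ∈ W := by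
  let π : W →ₗ[ℂ] Fin 2 → ℂ :=
    LinearMap.pi ![LinearMap.proj 0 ∘ₗ W.subtype, LinearMap.proj 2 ∘ₗ W.subtype]
  have hfin : Module.finrank ℂ W = Module.finrank ℂ (Fin 2 → ℂ) :=
    hW.1.trans (Module.finrank_fin_fun ℂ).symm
  by_cases hπ : Function.Injective π
  · have hsurj := (LinearMap.injective_iff_surjective_of_finrank_eq_finrank hfin).1 hπ
    obtain ⟨⟨y, hy⟩, hy'⟩ := hsurj ![1, 0]
    obtain ⟨⟨x, hx⟩, hx'⟩ := hsurj ![0, 1]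
    have y0 : y 0 = 1 := congrFun hy' 0
    have y2 : y 2 = 0 := congrFun hy' 1
    have x0 : x 0 = 0 := congrFun hx' 0
    have x2 : x 2 = 1 := congrFun hx' 1
    have e1 := hF y hy
    have e2 := hF x hx
    have e3 := hF _ (W.add_mem hy hx)
    have e4 := hF _ (W.sub_mem hy hx)
    simp only [Pi.add_apply, Pi.sub_apply, x0, x2, y0, y2] at e1 e2 e3 e4
    have y3 : y 3 = 0 := by linear_combination e1
    have y1 : y 1 = 0 := by linear_combination (e3 + e4) / 2 - e1
    refine ⟨1, 0, Or.inl one_ne_zero, ?_⟩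
    convert hy using 1
    ext i
    fin_cases i <;> simp [y0, y1, y2, y3]
  · rw [← LinearMap.ker_eq_bot, Submodule.eq_bot_iff] at hπ
    push Not at hπ
    obtain ⟨⟨y, hy⟩, hker, hne⟩ := hπ
    have y0 : y 0 = 0 := congrFun hker 0
    have y2 : y 2 = 0 := congrFun hker 1
    refine ⟨-conj (y 1), -conj (y 3), ?_, ?_⟩
    · by_contra! h
      simp only [neg_eq_zero, map_eq_zero] at h
      apply hne
      ext i
      fin_cases i <;> simp [y0, y2, h.1, h.2]
    · simpa [J, y0, y2] using hW.J_mem hy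

/-- The twistor lines on which `y₀² y₃ + y₂² y₁` vanishes. -/
theorem IsTwistorLine.eq_conjSpan_of_vanishes {W : Submodule ℂ (Fin 4 → ℂ)}
    (hW : IsTwistorLine W) (hF : ∀ y ∈ W, y 0 ^ 2 * y 3 + y 2 ^ 2 * y 1 = 0) :
    W = conjSpan 0 1 ∨ ∃ t : ℂ, conj t = -t ^ 2 ∧ W = conjSpan 1 t := by
  obtain ⟨s, t, hst, hmem⟩ := hW.exists_mem hF
  by_cases hs : s = 0
  · left
    subst hs
    have ht : t ≠ 0 := by simpa using hst
    refine hW.eq_conjSpan (Or.inr one_ne_zero) ?_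
    simpa [ht] using W.smul_mem t⁻¹ hmem
  · right
    have hmem' : ![1, 0, t / s, 0] ∈ W := by
      simpa [hs, div_eq_inv_mul] using W.smul_mem s⁻¹ hmem
    refine ⟨t / s, ?_, hW.eq_conjSpan (Or.inl one_ne_zero) hmem'⟩
    have := hF _ (W.add_mem hmem' (hW.J_mem hmem'))
    simp only [J, Pi.add_apply, Matrix.cons_val, map_zero, map_one] at this
    linear_combination this

theorem exists_cubeRoot : ∃ w : ℂ, w ^ 2 + w + 1 = 0 ∧ conj w = w ^ 2 := by
  have h3 : ((√3 : ℝ) : ℂ) ^ 2 = 3 := by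
    norm_cast
    simp
  refine ⟨-1 / 2 + (√3 : ℝ) / 2 * Complex.I, ?_, ?_⟩
  · linear_combination (Complex.I ^ 2 / 4) * h3 + 3 / 4 * Complex.I_sq
  · simp only [map_add, map_mul, map_div₀, map_neg, map_one, map_ofNat, Complex.conj_ofReal,
      Complex.conj_I]
    linear_combination -(Complex.I ^ 2 / 4) * h3 - 3 / 4 * Complex.I_sq

theorem conj_eq_neg_sq_iff {w : ℂ} (hw : w ^ 2 + w + 1 = 0) (hc : conj w = w ^ 2) (t : ℂ) :
    conj t = -t ^ 2 ↔ t ∈ ({0, -1, -w, -w ^ 2} : Set ℂ) := by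
  simp only [Set.mem_insert_iff, Set.mem_singleton_iff]
  constructor
  · intro h
    have h' : t = -conj t ^ 2 := by
      simpa using congrArg conj h
    rw [h] at h'
    have : t * ((t + 1) * ((t + w) * (t + w ^ 2))) = 0 := by
      linear_combination h' + (t * (t + 1) * (t + w - 1)) * hw
    simpa [add_eq_zero_iff_eq_neg] using this
  · rintro (rfl | rfl | rfl | rfl)
    · simp
    · simp
    · simp [hc]
    · simp only [map_neg, map_pow, hc]
      ring

theorem encard_neg_cubeRoots {w : ℂ} (hw : w ^ 2 + w + 1 = 0) :
    ({0, -1, -w, -w ^ 2} : Set ℂ).encard = 4 := by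
  have h0 : w ≠ 0 := by
    rintro rfl
    simp at hw
  have h1 : w ≠ 1 := by
    rintro rfl
    norm_num at hw
  have h2 : w ^ 2 ≠ 1 := by
    intro h
    have hw' : w = -2 := by linear_combination hw - h
    norm_num [hw'] at h
  have h3 : w ≠ w ^ 2 := by
    intro h
    apply h1
    apply mul_left_cancel₀ h0
    linear_combination -h
  rw [Set.encard_insert_of_notMem, Set.encard_insert_of_notMem, Set.encard_pair]
  · norm_num
  · simpa using h3
  · simp [h1.symm, h2.symm]
  · simp [h0]

theorem conjSpan_one_injective : Function.Injective (conjSpan 1) := by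
  intro t t' h
  have hmem : ![1, 0, t, 0] ∈ conjSpan 1 t' := by
    rw [← h]
    exact mem_conjSpan.2 ⟨1, 0, by simp⟩
  obtain ⟨a, b, hab⟩ := mem_conjSpan.1 hmem
  have h0 := congrFun hab 0
  have h2 := congrFun hab 2
  simp at h0 h2
  simpa [← h0] using h2

theorem conjSpan_zero_one_ne (t : ℂ) : conjSpan 0 1 ≠ conjSpan 1 t := by
  intro h
  have hmem : ![0, 0, 1, 0] ∈ conjSpan 1 t := by
    rw [← h]
    exact mem_conjSpan.2 ⟨1, 0, by simp⟩
  obtain ⟨a, b, hab⟩ := mem_conjSpan.1 hmem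
  have h0 := congrFun hab 0
  have h2 := congrFun hab 2
  simp at h0 h2
  simp [← h0] at h2

/-- The linear change of coordinates taking `J` to the required twistor structure. -/
def coordChange (w : ℂ) : (Fin 4 → ℂ) →ₗ[ℂ] (Fin 4 → ℂ) where
  toFun y := ![y 0 + w * y 3, -y 0 - y 3, y 2 + w * y 1, -y 2 - y 1]
  map_add' x y := by
    ext i
    fin_cases i <;> simp <;> ring
  map_smul' c y := by
    ext i
    fin_cases i <;> simp <;> ring

theorem coordChange_injective {w : ℂ} (hw : w ≠ 1) : Function.Injective (coordChange w) := by
  rw [← LinearMap.ker_eq_bot, Submodule.eq_bot_iff]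
  intro y hy
  have h0 : y 0 + w * y 3 = 0 := congrFun hy 0
  have h1 : -y 0 - y 3 = 0 := congrFun hy 1
  have h2 : y 2 + w * y 1 = 0 := congrFun hy 2
  have h3 : -y 2 - y 1 = 0 := congrFun hy 3
  have hw' : w - 1 ≠ 0 := sub_ne_zero.2 hw
  have y3 : y 3 = 0 := by
    apply mul_left_cancel₀ hw'
    linear_combination h0 + h1
  have y1 : y 1 = 0 := by
    apply mul_left_cancel₀ hw'
    linear_combination h2 + h3
  rw [y3] at h1
  rw [y1] at h3
  ext i
  fin_cases i
  · simpa using h1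
  · exact y1
  · simpa using h3
  · exact y3

theorem eval_fermat_coordChange {w : ℂ} (hw : w ^ 2 + w + 1 = 0) (y : Fin 4 → ℂ) :
    eval (coordChange w y)
        (X 0 ^ 3 + X 1 ^ 3 + X 2 ^ 3 + X 3 ^ 3 : MvPolynomial (Fin 4) ℂ) =
      3 * (w - 1) * ((y 0 ^ 2 * y 3 + y 2 ^ 2 * y 1)
        - w ^ 2 * (y 0 * y 3 ^ 2 + y 2 * y 1 ^ 2)) := by
  simp only [coordChange, LinearMap.coe_mk, AddHom.coe_mk, map_add, map_pow, eval_X,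
    Matrix.cons_val]
  linear_combination ((w - 1) * (y 1 ^ 3 + y 3 ^ 3)
    + 3 * (w - 1) * (y 0 * y 3 ^ 2 + y 2 * y 1 ^ 2)) * hw

theorem setOf_twistorLines {w : ℂ} (hw : w ^ 2 + w + 1 = 0) (hc : conj w = w ^ 2) :
    {W | IsTwistorLine W ∧ ∀ y ∈ W, eval (coordChange w y)
        (X 0 ^ 3 + X 1 ^ 3 + X 2 ^ 3 + X 3 ^ 3 : MvPolynomial (Fin 4) ℂ) = 0} =
      insert (conjSpan 0 1) (conjSpan 1 '' {0, -1, -w, -w ^ 2}) := by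
  have h1 : w - 1 ≠ 0 := by
    rw [sub_ne_zero]
    rintro rfl
    norm_num at hw
  have h0 : w ≠ 0 := by
    rintro rfl
    simp at hw
  simp only [eval_fermat_coordChange hw, mul_eq_zero, h1, OfNat.ofNat_ne_zero, false_or]
  ext W
  simp only [Set.mem_ofPred_eq, Set.mem_insert_iff, Set.mem_image, ← conj_eq_neg_sq_iff hw hc]
  constructor
  · rintro ⟨hW, hf⟩
    have hF : ∀ y ∈ W, y 0 ^ 2 * y 3 + y 2 ^ 2 * y 1 = 0 := by
      intro y hy
      have e1 := hf y hy
      have e2 := congrArg conj (hf _ (hW.J_mem hy))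
      simp only [J, Matrix.cons_val, map_sub, map_add, map_mul, map_pow, map_neg, hc,
        Complex.conj_conj, map_zero] at e2
      have e3 : 2 * w * (y 0 ^ 2 * y 3 + y 2 ^ 2 * y 1) = 0 := by
        linear_combination w * e1 + e2
          + ((y 0 * y 3 ^ 2 + y 2 * y 1 ^ 2) * (w - 1)
            - (y 0 ^ 2 * y 3 + y 2 ^ 2 * y 1) * (w * (w - 1))) * hw
      simpa [h0] using e3
    refine (hW.eq_conjSpan_of_vanishes hF).imp id ?_
    rintro ⟨t, ht, rfl⟩
    exact ⟨t, ht, rfl⟩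
  · rintro (rfl | ⟨t, ht, rfl⟩)
    · refine ⟨isTwistorLine_conjSpan (Or.inr one_ne_zero), fun y hy => ?_⟩
      obtain ⟨a, b, rfl⟩ := mem_conjSpan.1 hy
      simp
    · refine ⟨isTwistorLine_conjSpan (Or.inl one_ne_zero), fun y hy => ?_⟩
      obtain ⟨a, b, rfl⟩ := mem_conjSpan.1 hy
      have ht' : t = -conj t ^ 2 := by
        simpa using congrArg conj ht
      simp only [Matrix.cons_val, map_one]
      linear_combination a ^ 2 * b * ht - w ^ 2 * a * b ^ 2 * ht'

theorem setOf_conjugate_twistorLines (g : (Fin 4 → ℂ) ≃ₗ[ℂ] (Fin 4 → ℂ))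
    (f : MvPolynomial (Fin 4) ℂ) :
    {W : Submodule ℂ (Fin 4 → ℂ) | IsLine W ∧
        (fun z => g (J (g.symm z))) '' (W : Set (Fin 4 → ℂ)) = (W : Set (Fin 4 → ℂ)) ∧
        VanishesOn f W} =
      Submodule.map (g : (Fin 4 → ℂ) →ₗ[ℂ] (Fin 4 → ℂ)) ''
        {W | IsTwistorLine W ∧ ∀ y ∈ W, eval (g y) f = 0} := by
  have key (V : Submodule ℂ (Fin 4 → ℂ)) :
      V.map (g : (Fin 4 → ℂ) →ₗ[ℂ] (Fin 4 → ℂ)) ∈ {W : Submodule ℂ (Fin 4 → ℂ) | IsLine W ∧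
        (fun z => g (J (g.symm z))) '' (W : Set (Fin 4 → ℂ)) = (W : Set (Fin 4 → ℂ)) ∧
        VanishesOn f W} ↔ IsTwistorLine V ∧ ∀ y ∈ V, eval (g y) f = 0 := by
    have himage : (fun z => g (J (g.symm z))) '' (g '' (V : Set (Fin 4 → ℂ))) =
        g '' (J '' (V : Set (Fin 4 → ℂ))) := by
      simp [Set.image_image]
    have hvanishes : (∀ z, g.symm z ∈ V → eval z f = 0) ↔ ∀ y ∈ V, eval (g y) f = 0 :=
      ⟨fun h y hy => h _ (by simpa using hy), fun h z hz => by simpa using h _ hz⟩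
    simp [hvanishes, IsLine, IsTwistorLine, VanishesOn, himage, g.injective.image_injective.eq_iff,
      and_assoc, LinearEquiv.finrank_map_eq]
  ext W
  constructor
  · intro hW
    have hW' := Submodule.map_comap_eq_of_surjective (f := (g : (Fin 4 → ℂ) →ₗ[ℂ] _))
      g.surjective W
    rw [← hW'] at hW
    exact ⟨_, (key _).1 hW, hW'⟩
  · rintro ⟨V, hV, rfl⟩
    exact (key V).2 hV

/-- The Fermat cubic admits a twistor structure `g ∘ j ∘ g⁻¹` for which it has exactly
five twistor lines. -/
theorem Fermat_admits_structure_with_five_twistor_lines :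
    ∃ g : (Fin 4 → ℂ) ≃ₗ[ℂ] (Fin 4 → ℂ),
      {W : Submodule ℂ (Fin 4 → ℂ) | IsLine W ∧
        (fun z => g (J (g.symm z))) '' (W : Set (Fin 4 → ℂ)) = (W : Set (Fin 4 → ℂ)) ∧
        VanishesOn (X 0 ^ 3 + X 1 ^ 3 + X 2 ^ 3 + X 3 ^ 3 : MvPolynomial (Fin 4) ℂ) W}.encard
        = 5 := by
  obtain ⟨w, hw, hc⟩ := exists_cubeRoot
  have h1 : w ≠ 1 := by
    rintro rfl
    norm_num at hw
  let g := LinearEquiv.ofInjectiveEndo (coordChange w) (coordChange_injective h1)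
  refine ⟨g, ?_⟩
  rw [setOf_conjugate_twistorLines,
    (Submodule.map_injective_of_injective g.injective).encard_image]
  have hg : ∀ y, g y = coordChange w y := fun _ => rfl
  simp only [hg]
  rw [setOf_twistorLines hw hc, Set.encard_insert_of_notMem,
    conjSpan_one_injective.encard_image, encard_neg_cubeRoots hw]
  · norm_num
  · rintro ⟨t, -, ht⟩
    exact conjSpan_zero_one_ne t ht.symm
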